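/- Let N ≥ 1 and let A₁, …, A_N be finite nonempty types. For each i, let μ_i be a probability mass function on A_i × A_i whose first marginal is π_i and whose second marginal is π̃_i, and suppose μ_i({(a, ã) : a ≠ ã}) ≤ α_i with α_i ∈ [0,1]. Let A : (∏_i A_i) → ℝ satisfy |A(a)| ≤ ε for all joint actions a, and suppose the expectation of A under the product distribution ∏_i π_i is zero. Then the expectation of A under the product distribution ∏_i π̃_i satisfies |E_{ã∼∏_i π̃_i}[A(ã)]| ≤ 2ε · (1 − ∏_{i=1}^N (1 − α_i)). -/

import Mathlib

open scoped Classical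

/-- A product of sums over finite types is the sum, over dependent functions, of products. -/
theorem prod_sum_eq_sum_pi_prod {ι : Type*} [Fintype ι] [DecidableEq ι] {A : ι → Type*}
    [∀ i, Fintype (A i)] (f : ∀ i, A i → ℝ) :
    ∏ i, ∑ x, f i x = ∑ a : ∀ i, A i, ∏ i, f i (a i) := by
  rw [Finset.prod_univ_sum, Fintype.piFinset_univ]

/-- The mass of the diagonal and the mass of its complement add up to the total mass. -/
theorem sum_diag_add_sum_offDiag {B : Type*} [Fintype B] (m : B × B → ℝ) :
    ∑ x, m (x, x) + ∑ z ∈ Finset.univ.filter (fun z : B × B => z.1 ≠ z.2), m z = ∑ z, m z := by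
  rw [← Finset.sum_filter_add_sum_filter_not Finset.univ (fun z : B × B => z.1 = z.2) m]
  congr 1
  rw [Finset.sum_filter, Fintype.sum_prod_type]
  simp

/-- Two expectations of a bounded function differ by at most twice the bound times the
off-diagonal mass of a coupling. -/
theorem abs_sum_sum_mul_sub_le {B : Type*} [Fintype B] (P : B → B → ℝ) (g : B → ℝ) (ε : ℝ)
    (hP : ∀ a b, 0 ≤ P a b) (hg : ∀ a, |g a| ≤ ε) :
    |∑ a, ∑ b, P a b * (g b - g a)| ≤ 2 * ε * (∑ a, ∑ b, P a b - ∑ a, P a a) := by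
  have hterm : ∀ a b, |P a b * (g b - g a)| ≤ 2 * ε * (P a b - if a = b then P a b else 0) := by
    intro a b
    by_cases hab : a = b
    · simp [hab]
    · rw [abs_mul, abs_of_nonneg (hP a b), if_neg hab, sub_zero, mul_comm]
      refine mul_le_mul_of_nonneg_right ?_ (hP a b)
      linarith [abs_sub (g b) (g a), hg a, hg b]
  calc |∑ a, ∑ b, P a b * (g b - g a)|
      ≤ ∑ a, ∑ b, |P a b * (g b - g a)| :=
        (Finset.abs_sum_le_sum_abs _ _).trans
          (Finset.sum_le_sum fun a _ => Finset.abs_sum_le_sum_abs _ _)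
    _ ≤ ∑ a, ∑ b, 2 * ε * (P a b - if a = b then P a b else 0) :=
        Finset.sum_le_sum fun a _ => Finset.sum_le_sum fun b _ => hterm a b
    _ = 2 * ε * (∑ a, ∑ b, P a b - ∑ a, P a a) := by
        simp [← Finset.mul_sum, Finset.sum_sub_distrib]

/-- Key per-state lemma (Eq. (15)) in the proof of Theorem 1: if each `μ i` is a coupling
of `π i` and `π̃ i` with mismatch probability at most `α i ∈ [0,1]`, `|Adv| ≤ ε`, and the
expectation of `Adv` under the product of the `π i` vanishes, then the expectation of
`Adv` under the product of the `π̃ i` is at most `2ε (1 − ∏ i, (1 − α i))` in absolute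
value. -/
theorem abs_expected_adv_new_policy_le (N : ℕ) (hN : 1 ≤ N) (A : Fin N → Type*)
    [∀ i, Fintype (A i)] [∀ i, Nonempty (A i)]
    (μ : ∀ i, A i × A i → ℝ) (π πt : ∀ i, A i → ℝ) (α : Fin N → ℝ)
    (Adv : (∀ i, A i) → ℝ) (ε : ℝ)
    (hnn : ∀ i z, 0 ≤ μ i z) (hsum : ∀ i, ∑ z, μ i z = 1)
    (hm1 : ∀ i a, ∑ b, μ i (a, b) = π i a)
    (hm2 : ∀ i b, ∑ a, μ i (a, b) = πt i b)
    (hmis : ∀ i, ∑ z ∈ Finset.univ.filter (fun z : A i × A i => z.1 ≠ z.2), μ i z ≤ α i)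
    (hα0 : ∀ i, 0 ≤ α i) (hα1 : ∀ i, α i ≤ 1)
    (hAdv : ∀ a, |Adv a| ≤ ε)
    (hzero : ∑ a : ∀ i, A i, (∏ i, π i (a i)) * Adv a = 0) :
    |∑ a : ∀ i, A i, (∏ i, πt i (a i)) * Adv a| ≤ 2 * ε * (1 - ∏ i, (1 - α i)) := by
  set P : (∀ i, A i) → (∀ i, A i) → ℝ := fun a b => ∏ i, μ i (a i, b i) with hPdef
  have hrow : ∀ a, ∑ b, P a b = ∏ i, π i (a i) := fun a => by
    simp only [hPdef, ← hm1, prod_sum_eq_sum_pi_prod]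
  have hcol : ∀ b, ∑ a, P a b = ∏ i, πt i (b i) := fun b => by
    simp only [hPdef, ← hm2, prod_sum_eq_sum_pi_prod]
  have htotal : ∑ a, ∑ b, P a b = 1 := by
    simp only [hrow]
    rw [← prod_sum_eq_sum_pi_prod]
    refine Finset.prod_eq_one fun i _ => ?_
    simp only [← hm1, ← Fintype.sum_prod_type, hsum]
  have hdiag : ∏ i, (1 - α i) ≤ ∑ a, P a a := by
    simp only [hPdef]
    rw [← prod_sum_eq_sum_pi_prod (fun i x => μ i (x, x))]
    refine Finset.prod_le_prod (fun i _ => sub_nonneg.2 (hα1 i)) fun i _ => ?_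
    linarith [sum_diag_add_sum_offDiag (μ i), hmis i, hsum i]
  have hE : ∑ a : ∀ i, A i, (∏ i, πt i (a i)) * Adv a
      = ∑ a, ∑ b, P a b * (Adv b - Adv a) := by
    simp only [mul_sub, Finset.sum_sub_distrib, ← Finset.sum_mul, hrow, hzero, sub_zero]
    rw [Finset.sum_comm]
    simp only [← Finset.sum_mul, hcol]
  have hε : 0 ≤ ε := (abs_nonneg _).trans (hAdv fun i => Classical.arbitrary (A i))
  rw [hE]
  refine (abs_sum_sum_mul_sub_le P Adv ε
    (fun a b => Finset.prod_nonneg fun i _ => hnn i _) hAdv).trans ?_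
  rw [htotal]
  gcongr
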